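/- arXiv:math/0503739 — 2 statements merged into one kernel-verified Lean document; each statement's English description precedes it below -/
import Mathlib

section
/- Let V_* be a filtration of V and let N be a nilpotent endomorphism of V with N ∈ E_{≥2}V_*. Assume that for every n ≥ 0 the map gr_{−n} V_* → gr_n V_* induced by N^n is an isomorphism. Then V_{≥a} = V^N_{≥a} for every a ∈ ℤ. -/
/-- The canonical (Dynkin–Kostant) filtration attached to a nilpotent endomorphism:
`V^N_{≥a} = Σ_{j ≥ max(0,a)} N^j (ker N^{2j−a+1})`. -/
noncomputable def canonFilt {k : Type*} [Field k] {V : Type*} [AddCommGroup V] [Module k V]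
    (N : V →ₗ[k] V) (a : ℤ) : Submodule k V :=
  ⨆ j : {j : ℕ // a ≤ (j : ℤ)},
    Submodule.map (N ^ (j : ℕ)) (LinearMap.ker (N ^ (2 * ((j : ℕ) : ℤ) - a + 1).toNat))

section

variable {k : Type*} [Field k] {V : Type*} [AddCommGroup V] [Module k V]
  {F : ℤ → Submodule k V} {N : V →ₗ[k] V}

theorem pow_apply_mem_canonFilt {a : ℤ} {j m : ℕ} (haj : a ≤ j) (hm : (m : ℤ) ≤ 2 * j - a + 1)
    {v : V} (hv : (N ^ m) v = 0) : (N ^ j) v ∈ canonFilt N a := by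
  refine Submodule.mem_iSup_of_mem (⟨j, haj⟩ : {j : ℕ // a ≤ (j : ℤ)}) ?_
  exact Submodule.mem_map_of_mem (LinearMap.mem_ker.2
    (Module.End.pow_map_zero_of_le (by dsimp only; omega) hv))

theorem apply_mem_canonFilt {a : ℤ} {v : V} (hv : v ∈ canonFilt N a) :
    N v ∈ canonFilt N (a + 2) := by
  suffices canonFilt N a ≤ (canonFilt N (a + 2)).comap N from this hv
  refine iSup_le ?_
  rintro ⟨j, hj⟩
  rintro _ ⟨w, hw, rfl⟩
  have hw' : (N ^ (2 * (j : ℤ) - a + 1).toNat) w = 0 := hw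
  rw [Submodule.mem_comap, ← Module.End.mul_apply, ← pow_succ']
  by_cases h : a = j
  · rw [Module.End.pow_map_zero_of_le (by dsimp only; omega) hw']
    exact zero_mem _
  · exact pow_apply_mem_canonFilt (by push_cast; omega) (by push_cast; omega) hw'

theorem pow_apply_mem_canonFilt_add {a : ℤ} {v : V} (hv : v ∈ canonFilt N a) (n : ℕ) :
    (N ^ n) v ∈ canonFilt N (a + 2 * n) := by
  induction n with
  | zero => simpa using hv
  | succ n ih =>
    rw [pow_succ', Module.End.mul_apply]
    convert apply_mem_canonFilt ih using 2
    push_cast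
    ring

theorem pow_apply_mem_of_degree_two (hdeg : ∀ a : ℤ, ∀ x ∈ F a, N x ∈ F (a + 2))
    {a : ℤ} {x : V} (hx : x ∈ F a) (n : ℕ) : (N ^ n) x ∈ F (a + 2 * n) := by
  induction n with
  | zero => simpa using hx
  | succ n ih =>
    rw [pow_succ', Module.End.mul_apply]
    convert hdeg _ _ ih using 2
    push_cast
    ring

/-- Injectivity of `N ^ n` on graded pieces forces `ker N ^ (m + 1)` into `F (-m)`. -/
theorem mem_of_pow_succ_apply_eq_zero (hanti : Antitone F) (htop : ∃ a : ℤ, F a = ⊤)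
    (hLefInj : ∀ n : ℕ, ∀ x ∈ F (-(n : ℤ)), (N ^ n) x ∈ F ((n : ℤ) + 1) →
      x ∈ F (-(n : ℤ) + 1))
    {m : ℕ} {x : V} (hx : (N ^ (m + 1)) x = 0) : x ∈ F (-(m : ℤ)) := by
  obtain ⟨t, ht⟩ := htop
  have hmem (i : ℕ) : x ∈ F (-((m + i : ℕ) : ℤ)) → x ∈ F (-(m : ℤ)) := by
    induction i with
    | zero => exact id
    | succ i ih =>
      intro h
      refine ih ?_
      have hzero : (N ^ (m + (i + 1))) x = 0 :=
        Module.End.pow_map_zero_of_le (by omega) hx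
      have hstep := hLefInj _ x h (by rw [hzero]; exact zero_mem _)
      convert hstep using 2
      push_cast
      ring
  refine hmem t.natAbs (hanti (show _ ≤ t by omega) ?_)
  rw [ht]
  trivial

/-- Surjectivity of `N ^ n` on graded pieces lifts to surjectivity `F (-n) → F n`. -/
theorem exists_pow_apply_eq_of_mem (hanti : Antitone F) (hbot : ∃ a : ℤ, F a = ⊥)
    (hdeg : ∀ a : ℤ, ∀ x ∈ F a, N x ∈ F (a + 2))
    (hLefSurj : ∀ n : ℕ, ∀ y ∈ F (n : ℤ), ∃ x ∈ F (-(n : ℤ)),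
      (N ^ n) x - y ∈ F ((n : ℤ) + 1))
    (n : ℕ) {y : V} (hy : y ∈ F (n : ℤ)) : ∃ x ∈ F (-(n : ℤ)), (N ^ n) x = y := by
  obtain ⟨b, hb⟩ := hbot
  obtain ⟨d, hd⟩ : ∃ d : ℕ, b ≤ n + d := ⟨b.natAbs, by omega⟩
  induction d generalizing n y with
  | zero =>
    have hy0 : y ∈ F b := hanti (by simpa using hd) hy
    rw [hb, Submodule.mem_bot] at hy0
    exact ⟨0, zero_mem _, by simp [hy0]⟩
  | succ d ih =>
    obtain ⟨x, hx, hxy⟩ := hLefSurj n y hy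
    obtain ⟨z, hz, hzy⟩ := ih (n + 1) (y := (N ^ n) x - y) (by exact_mod_cast hxy)
      (by push_cast at hd ⊢; omega)
    refine ⟨x - N z, sub_mem hx (hanti (by push_cast; omega) (hdeg _ _ hz)), ?_⟩
    rw [map_sub, ← Module.End.mul_apply, ← pow_succ, hzy]
    abel

end

/-- if `V_*` is a filtration, `N` is nilpotent with `N ∈ E_{≥2}V_*`, and
`N^n` induces an isomorphism `gr_{−n}V_* → gr_n V_*` for all `n ≥ 0` (stated at the
level of elements), then `V_*` is the canonical filtration `V^N_*`. -/
theorem stmt_4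
    (k : Type*) [Field k] (V : Type*) [AddCommGroup V] [Module k V]
    [FiniteDimensional k V]
    (F : ℤ → Submodule k V)
    (hdec : ∀ a : ℤ, F (a + 1) ≤ F a)
    (hbot : ∃ a : ℤ, F a = ⊥)
    (htop : ∃ a : ℤ, F a = ⊤)
    (N : V →ₗ[k] V) (hN : IsNilpotent N)
    (hdeg : ∀ a : ℤ, ∀ x ∈ F a, N x ∈ F (a + 2))
    (hLefInj : ∀ n : ℕ, ∀ x ∈ F (-(n : ℤ)), (N ^ n) x ∈ F ((n : ℤ) + 1) →
      x ∈ F (-(n : ℤ) + 1))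
    (hLefSurj : ∀ n : ℕ, ∀ y ∈ F (n : ℤ), ∃ x ∈ F (-(n : ℤ)),
      (N ^ n) x - y ∈ F ((n : ℤ) + 1)) :
    ∀ a : ℤ, F a = canonFilt N a := by
  have hanti : Antitone F := antitone_int_of_succ_le hdec
  have hsurj := fun n : ℕ => fun y => exists_pow_apply_eq_of_mem (y := y) hanti hbot hdeg hLefSurj n
  have hneg (n : ℕ) : F (-(n : ℤ)) ≤ canonFilt N (-(n : ℤ)) := by
    obtain ⟨r, hr⟩ := hN
    obtain ⟨d, hd⟩ : ∃ d : ℕ, r ≤ n + d := ⟨r, by omega⟩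
    induction d generalizing n with
    | zero =>
      intro x _
      exact pow_apply_mem_canonFilt (j := 0) (m := r) (by simp) (by push_cast; omega) (by simp [hr])
    | succ d ih =>
      intro x hx
      have hpow := pow_apply_mem_of_degree_two hdeg hx (n + 1)
      obtain ⟨z, hz, hzx⟩ := hsurj (n + 2) ((N ^ (n + 1)) x)
        (hanti (by push_cast; omega) hpow)
      have hNz := apply_mem_canonFilt (ih (n + 2) (by omega) hz)
      rw [show -((n + 2 : ℕ) : ℤ) + 2 = -(n : ℤ) by push_cast; ring] at hNz
      have hker : (N ^ (n + 1)) (x - N z) = 0 := by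
        rw [map_sub, ← Module.End.mul_apply, ← pow_succ, hzx, sub_self]
      have hsub : x - N z ∈ canonFilt N (-(n : ℤ)) :=
        pow_apply_mem_canonFilt (j := 0) (by simp) (by push_cast; omega) hker
      simpa using add_mem hsub hNz
  intro a
  apply le_antisymm
  · obtain ⟨n, rfl | rfl⟩ := a.eq_nat_or_neg
    · intro y hy
      obtain ⟨x, hx, rfl⟩ := hsurj n y hy
      convert pow_apply_mem_canonFilt_add (hneg n hx) n using 2
      ring
    · exact hneg n
  · refine iSup_le ?_
    rintro ⟨j, hj⟩
    rintro _ ⟨w, hw, rfl⟩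
    obtain ⟨m, hm⟩ : ∃ m : ℕ, (m : ℤ) = 2 * j - a := ⟨(2 * (j : ℤ) - a).toNat, by omega⟩
    have hw' : (N ^ (m + 1)) w = 0 := Module.End.pow_map_zero_of_le (by dsimp only; omega) hw
    exact hanti (by omega) (pow_apply_mem_of_degree_two hdeg
      (mem_of_pow_succ_apply_eq_zero hanti htop hLefInj hw') j)
end

section
/- Let N be a nilpotent endomorphism of V, set V_* = V^N_*, and let ν_a : gr_a V_* → gr_{a+2} V_* be the maps induced by N. Suppose that for each a ∈ ℤ a linear map σ_a : gr_a V_* → gr_{a+1} V_* is given with σ_{a+2}∘ν_a = ν_{a+1}∘σ_a for all a. Then there exists S ∈ E_{≥1}V_* with SN = NS such that the map gr_a V_* → gr_{a+1} V_* induced by S equals σ_a for every a. -/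
/-- The graded piece `gr_a V_* = V_{≥a}/V_{≥a+1}` of a filtration. -/
abbrev gradedPiece {k : Type*} [Field k] {V : Type*} [AddCommGroup V] [Module k V]
    (F : ℤ → Submodule k V) (a : ℤ) :=
  F a ⧸ Submodule.comap (F a).subtype (F (a + 1))

/-- Transport between graded pieces along an equality of indices. -/
noncomputable def grCast {k : Type*} [Field k] {V : Type*} [AddCommGroup V] [Module k V]
    (F : ℤ → Submodule k V) {a b : ℤ} (h : a = b) :
    gradedPiece F a ≃ₗ[k] gradedPiece F b := by
  subst h; exact LinearEquiv.refl _ _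

open Polynomial in
/-- A nilpotent endomorphism `N` has a family `e i` of generators of Jordan blocks of size `n i`:
commuting endomorphisms may be prescribed freely on the `e i` subject to `N ^ n i` killing the
values, and the kernels of the powers of `N` are spanned by vectors `N ^ l (e i)`. -/
theorem exists_jordan_generators {k V : Type*} [Field k] [AddCommGroup V] [Module k V]
    [FiniteDimensional k V] (N : V →ₗ[k] V) (hN : IsNilpotent N) :
    ∃ (d : ℕ) (n : Fin d → ℕ) (e : Fin d → V),
      (∀ i, (N ^ n i) (e i) = 0) ∧
      (∀ y : Fin d → V, (∀ i, (N ^ n i) (y i) = 0) →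
        ∃ S : V →ₗ[k] V, S ∘ₗ N = N ∘ₗ S ∧ ∀ i, S (e i) = y i) ∧
      (∀ m : ℕ, LinearMap.ker (N ^ m) ≤
        Submodule.span k {x | ∃ i l, n i ≤ l + m ∧ x = (N ^ l) (e i)}) := by
  classical
  have htor : Module.IsTorsion' (Module.AEval' N) (Submonoid.powers (X : k[X])) := by
    obtain ⟨m, hm⟩ := hN
    intro x
    refine ⟨⟨X ^ m, m, rfl⟩, ?_⟩
    change (X ^ m : k[X]) • x = 0
    apply (Module.AEval'.of N).symm.injective
    rw [Module.AEval.of_symm_smul, aeval_X_pow, hm, zero_smul, map_zero]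
  obtain ⟨d, n, ⟨φ⟩⟩ := Module.torsion_by_prime_power_decomposition
    (Polynomial.irreducible_X (R := k)) htor
  let Q : Fin d → Type _ := fun i => k[X] ⧸ Submodule.span k[X] {(X : k[X]) ^ n i}
  let g : ∀ i, DirectSum (Fin d) Q := fun i =>
    DirectSum.lof k[X] (Fin d) Q i (Submodule.Quotient.mk 1)
  have hg : ∀ i (p : k[X]),
      DirectSum.lof k[X] (Fin d) Q i (Submodule.Quotient.mk p) = p • g i := by
    intro i p
    rw [← map_smul, ← Submodule.Quotient.mk_smul, smul_eq_mul, mul_one]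
  have hXg : ∀ i, (X ^ n i : k[X]) • g i = 0 := by
    intro i
    rw [← hg, (Submodule.Quotient.mk_eq_zero _).mpr (Submodule.mem_span_singleton_self _), map_zero]
  refine ⟨d, n, fun i => (Module.AEval'.of N).symm (φ.symm (g i)), ?_, ?_, ?_⟩
  · intro i
    have h : (X ^ n i : k[X]) • φ.symm (g i) = 0 := by rw [← map_smul, hXg, map_zero]
    have h' := congrArg (Module.AEval'.of N).symm h
    rwa [Module.AEval.of_symm_smul, aeval_X_pow, map_zero] at h'
  · intro y hy
    let T : DirectSum (Fin d) Q →ₗ[k[X]] Module.AEval' N :=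
      DirectSum.toModule k[X] (Fin d) _ fun i =>
        Submodule.liftQ _ (LinearMap.toSpanSingleton k[X] _ (Module.AEval'.of N (y i))) (by
          rw [Submodule.span_singleton_le_iff_mem, LinearMap.mem_ker,
            LinearMap.toSpanSingleton_apply, Module.AEval'.X_pow_smul_of]
          change Module.AEval'.of N ((N ^ n i) (y i)) = 0
          rw [hy, map_zero])
    let U : Module.AEval' N →ₗ[k[X]] Module.AEval' N := T ∘ₗ φ.toLinearMap
    refine ⟨(Module.AEval'.of N).symm.toLinearMap ∘ₗ U.restrictScalars k ∘ₗ
      (Module.AEval'.of N).toLinearMap, ?_, ?_⟩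
    · ext v
      change (Module.AEval'.of N).symm (U (Module.AEval'.of N (N v))) =
        N ((Module.AEval'.of N).symm (U (Module.AEval'.of N v)))
      rw [← Module.AEval'.X_smul_of, map_smul, Module.AEval'.of_symm_X_smul]
    · intro i
      change (Module.AEval'.of N).symm (T (φ (φ.symm (g i)))) = y i
      rw [LinearEquiv.apply_symm_apply, LinearEquiv.symm_apply_eq]
      change T (DirectSum.lof k[X] (Fin d) Q i (Submodule.Quotient.mk 1)) = _
      rw [DirectSum.toModule_lof]
      exact one_smul k[X] (Module.AEval'.of N (y i))
  · intro m u hu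
    have hker : (X ^ m : k[X]) • φ (Module.AEval'.of N u) = 0 := by
      rw [← map_smul, Module.AEval'.X_pow_smul_of]
      change φ (Module.AEval'.of N ((N ^ m) u)) = 0
      rw [LinearMap.mem_ker.mp hu, map_zero, map_zero]
    choose p hp using fun i => Submodule.Quotient.mk_surjective _ (φ (Module.AEval'.of N u) i)
    have hsum : φ (Module.AEval'.of N u) = ∑ i, p i • g i := by
      conv_lhs => rw [← DirectSum.sum_univ_of (φ (Module.AEval'.of N u))]
      refine Finset.sum_congr rfl fun i _ => ?_
      rw [← hg, hp]
      rfl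
    have hu' : u = ∑ i, (aeval N (p i)) ((Module.AEval'.of N).symm (φ.symm (g i))) := by
      have h := congrArg (fun z => (Module.AEval'.of N).symm (φ.symm z)) hsum
      simp only [LinearEquiv.symm_apply_apply, map_sum, map_smul, Module.AEval.of_symm_smul] at h
      exact h
    rw [hu']
    refine Submodule.sum_mem _ fun i _ => ?_
    rw [aeval_eq_sum_range, LinearMap.sum_apply]
    refine Submodule.sum_mem _ fun l _ => ?_
    rw [LinearMap.smul_apply]
    by_cases hl : n i ≤ l + m
    · exact Submodule.smul_mem _ _ (Submodule.subset_span ⟨i, l, hl, rfl⟩)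
    · have hdvd : (X : k[X]) ^ n i ∣ p i * X ^ m := by
        have h : (X ^ m : k[X]) • (φ (Module.AEval'.of N u) i) = 0 := by
          rw [← DirectSum.smul_apply, hker]; rfl
        rw [← hp, ← Submodule.Quotient.mk_smul, Submodule.Quotient.mk_eq_zero,
          Submodule.mem_span_singleton] at h
        obtain ⟨c, hc⟩ := h
        exact ⟨c, by rw [mul_comm, ← smul_eq_mul, ← hc, smul_eq_mul, mul_comm]⟩
      have h0 := X_pow_dvd_iff.mp hdvd (l + m) (by omega)
      rw [coeff_mul_X_pow] at h0
      rw [h0, zero_smul]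
      exact Submodule.zero_mem _

/-- The canonical filtration in terms of Jordan generators: `N ^ l (e i)` has weight
`2 * l + 1 - n i`. -/
theorem canonFilt_eq_span {k V ι : Type*} [Field k] [AddCommGroup V] [Module k V]
    (N : V →ₗ[k] V) (n : ι → ℕ) (e : ι → V) (he : ∀ i, (N ^ n i) (e i) = 0)
    (hker : ∀ m : ℕ, LinearMap.ker (N ^ m) ≤
        Submodule.span k {x | ∃ i l, n i ≤ l + m ∧ x = (N ^ l) (e i)}) (a : ℤ) :
    canonFilt N a =
      Submodule.span k {x | ∃ i, ∃ l : ℕ, a ≤ 2 * l + 1 - n i ∧ x = (N ^ l) (e i)} := by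
  have hzero : ∀ i m, n i ≤ m → (N ^ m) (e i) = 0 := fun i m h => by
    rw [← Nat.sub_add_cancel h, pow_add, Module.End.mul_apply, he, map_zero]
  apply le_antisymm
  · refine iSup_le fun ⟨j, hj⟩ => ?_
    refine (Submodule.map_mono (hker _)).trans ?_
    rw [Submodule.map_span, Submodule.span_le]
    rintro _ ⟨_, ⟨i, l, hl, rfl⟩, rfl⟩
    refine Submodule.subset_span ⟨i, j + l, ?_, by rw [pow_add, Module.End.mul_apply]⟩
    dsimp only at hl
    omega
  · rw [Submodule.span_le]
    rintro _ ⟨i, l, hl, rfl⟩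
    by_cases h : a ≤ l
    · refine Submodule.mem_iSup_of_mem (⟨l, h⟩ : {j : ℕ // a ≤ (j : ℤ)}) ⟨e i, ?_, rfl⟩
      exact hzero i _ (by dsimp only; omega)
    · rw [hzero i l (by omega)]
      exact Submodule.zero_mem _

/-- For `n ≤ a`, the map `N ^ n` sends `V_{≥ a - 2n}` onto `V_{≥ a}`. -/
theorem canonFilt_le_map_pow {k V : Type*} [Field k] [AddCommGroup V] [Module k V]
    (N : V →ₗ[k] V) (n : ℕ) (a : ℤ) (ha : n ≤ a) :
    canonFilt N a ≤ (canonFilt N (a - 2 * n)).map (N ^ n) := by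
  refine iSup_le fun ⟨j, hj⟩ => ?_
  rintro _ ⟨u, hu, rfl⟩
  have hnj : n ≤ j := by omega
  refine ⟨(N ^ (j - n)) u, ?_, ?_⟩
  · refine Submodule.mem_iSup_of_mem
      (⟨j - n, by omega⟩ : {i : ℕ // a - 2 * n ≤ (i : ℤ)}) ⟨u, ?_, rfl⟩
    convert hu using 4
    dsimp only
    omega
  · rw [← Module.End.mul_apply, ← pow_add, Nat.add_sub_cancel' hnj]

theorem grCast_mk {k V : Type*} [Field k] [AddCommGroup V] [Module k V]
    (F : ℤ → Submodule k V) {a b : ℤ} (h : a = b) (x : V) (hx : x ∈ F a) :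
    grCast F h (Submodule.Quotient.mk ⟨x, hx⟩) = Submodule.Quotient.mk ⟨x, h ▸ hx⟩ := by
  subst h
  rfl

/-- `y` represents the image under `σ a` of the class of `x` in the graded piece of degree `a`. -/
def Represents {k V : Type*} [Field k] [AddCommGroup V] [Module k V] (F : ℤ → Submodule k V)
    (σ : ∀ a : ℤ, gradedPiece F a →ₗ[k] gradedPiece F (a + 1)) (a : ℤ) (x y : V) : Prop :=
  ∃ (hx : x ∈ F a) (hy : y ∈ F (a + 1)),
    σ a (Submodule.Quotient.mk ⟨x, hx⟩) = Submodule.Quotient.mk ⟨y, hy⟩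

namespace Represents

variable {k V : Type*} [Field k] [AddCommGroup V] [Module k V] {F : ℤ → Submodule k V}
  {σ : ∀ a : ℤ, gradedPiece F a →ₗ[k] gradedPiece F (a + 1)} {a : ℤ} {x y x' y' : V}

theorem add (h : Represents F σ a x y) (h' : Represents F σ a x' y') :
    Represents F σ a (x + x') (y + y') := by
  obtain ⟨hx, hy, h⟩ := h
  obtain ⟨hx', hy', h'⟩ := h'
  refine ⟨add_mem hx hx', add_mem hy hy', ?_⟩
  have := congrArg₂ (· + ·) h h'
  simp only [← map_add, ← Submodule.Quotient.mk_add] at this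
  exact this

theorem smul (c : k) (h : Represents F σ a x y) : Represents F σ a (c • x) (c • y) := by
  obtain ⟨hx, hy, h⟩ := h
  refine ⟨Submodule.smul_mem _ c hx, Submodule.smul_mem _ c hy, ?_⟩
  have := congrArg (c • ·) h
  simp only [← map_smul, ← Submodule.Quotient.mk_smul] at this
  exact this

theorem of_mem_succ (hF : Antitone F) (hx : x ∈ F (a + 1)) (hy : y ∈ F (a + 1 + 1)) :
    Represents F σ a x y := by
  refine ⟨hF (by omega) hx, hF (by omega) hy, ?_⟩
  rw [(Submodule.Quotient.mk_eq_zero _).mpr (show _ ∈ Submodule.comap _ _ from hx),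
    (Submodule.Quotient.mk_eq_zero _).mpr (show _ ∈ Submodule.comap _ _ from hy), map_zero]

theorem mem_of_zero (h : Represents F σ a 0 y) : y ∈ F (a + 1 + 1) := by
  obtain ⟨hx, hy, h⟩ := h
  rw [(Submodule.Quotient.mk_eq_zero _).mpr
    (show _ ∈ Submodule.comap _ _ from Submodule.zero_mem (F (a + 1))), map_zero] at h
  have hmem := (Submodule.Quotient.mk_eq_zero _).mp h.symm
  exact hmem

theorem exists_of_mem (hx : x ∈ F a) : ∃ y, Represents F σ a x y := by
  obtain ⟨⟨y, hy⟩, h⟩ := Submodule.Quotient.mk_surjective _ (σ a (Submodule.Quotient.mk ⟨x, hx⟩))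
  exact ⟨y, hx, hy, h.symm⟩

theorem pow_apply {N : V →ₗ[k] V} (hNF : ∀ a, ∀ x ∈ F a, N x ∈ F (a + 2))
    {ν : ∀ a : ℤ, gradedPiece F a →ₗ[k] gradedPiece F (a + 2)}
    (hν : ∀ (a : ℤ) (x : V) (hx : x ∈ F a) (hNx : N x ∈ F (a + 2)),
      ν a (Submodule.Quotient.mk ⟨x, hx⟩) = Submodule.Quotient.mk ⟨N x, hNx⟩)
    (hcomm : ∀ (a : ℤ) (z : gradedPiece F a),
      σ (a + 2) (ν a z) = grCast F (by ring) (ν (a + 1) (σ a z)))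
    (h : Represents F σ a x y) (l : ℕ) :
    Represents F σ (a + 2 * l) ((N ^ l) x) ((N ^ l) y) := by
  induction l with
  | zero => simpa using h
  | succ l ih =>
    obtain ⟨hx, hy, h⟩ := ih
    have hc := hcomm _ (Submodule.Quotient.mk ⟨_, hx⟩)
    rw [hν _ _ hx (hNF _ _ hx), h, hν _ _ hy (hNF _ _ hy), grCast_mk] at hc
    rw [pow_succ', Module.End.mul_apply, Module.End.mul_apply,
      show a + 2 * ((l + 1 : ℕ) : ℤ) = a + 2 * l + 2 by push_cast; ring]
    exact ⟨_, _, hc⟩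

end Represents

/-- a degree-1 endomorphism `σ` of `gr V^N_*` commuting with the induced
map `ν` lifts to `S ∈ E_{≥1}V^N_*` commuting with `N`. -/
theorem stmt_5
    (k : Type*) [Field k] (V : Type*) [AddCommGroup V] [Module k V]
    [FiniteDimensional k V]
    (N : V →ₗ[k] V) (hN : IsNilpotent N)
    (F : ℤ → Submodule k V) (hF : ∀ a : ℤ, F a = canonFilt N a)
    (ν : ∀ a : ℤ, gradedPiece F a →ₗ[k] gradedPiece F (a + 2))
    (hν : ∀ (a : ℤ) (x : V) (hx : x ∈ F a) (hNx : N x ∈ F (a + 2)),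
      ν a (Submodule.Quotient.mk ⟨x, hx⟩) = Submodule.Quotient.mk ⟨N x, hNx⟩)
    (σ : ∀ a : ℤ, gradedPiece F a →ₗ[k] gradedPiece F (a + 1))
    (hcomm : ∀ (a : ℤ) (z : gradedPiece F a),
      σ (a + 2) (ν a z) = grCast F (by ring) (ν (a + 1) (σ a z))) :
    ∃ S : V →ₗ[k] V,
      (∀ a : ℤ, ∀ x ∈ F a, S x ∈ F (a + 1)) ∧
      S ∘ₗ N = N ∘ₗ S ∧
      (∀ (a : ℤ) (x : V) (hx : x ∈ F a) (hSx : S x ∈ F (a + 1)),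
        σ a (Submodule.Quotient.mk ⟨x, hx⟩) = Submodule.Quotient.mk ⟨S x, hSx⟩) := by
  obtain ⟨d, n, e, he, hlift, hker⟩ := exists_jordan_generators N hN
  have hspan : ∀ a : ℤ, F a =
      Submodule.span k {x | ∃ i, ∃ l : ℕ, a ≤ 2 * l + 1 - n i ∧ x = (N ^ l) (e i)} :=
    fun a => (hF a).trans (canonFilt_eq_span N n e he hker a)
  have hanti : Antitone F := by
    intro a b hab
    rw [hspan, hspan]
    exact Submodule.span_mono fun x ⟨i, l, hl, hx⟩ => ⟨i, l, hab.trans hl, hx⟩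
  have hNF : ∀ a, ∀ x ∈ F a, N x ∈ F (a + 2) := by
    intro a
    change F a ≤ (F (a + 2)).comap N
    rw [hspan, hspan, Submodule.span_le]
    rintro _ ⟨i, l, hl, rfl⟩
    refine Submodule.subset_span ⟨i, l + 1, ?_, by rw [pow_succ', Module.End.mul_apply]⟩
    push_cast
    omega
  have hgen : ∀ i, ∃ y, (N ^ n i) y = 0 ∧ Represents F σ (1 - n i) (e i) y := by
    intro i
    have hei : e i ∈ F (1 - n i) := by
      rw [hspan]
      exact Submodule.subset_span ⟨i, 0, by simp, rfl⟩
    obtain ⟨y, hy⟩ := Represents.exists_of_mem (σ := σ) hei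
    have hNy := hy.pow_apply hNF hν hcomm (n i)
    rw [he] at hNy
    have hmem := hNy.mem_of_zero
    rw [hF] at hmem
    obtain ⟨z, hz, hzy⟩ := canonFilt_le_map_pow N (n i) _ (by omega) hmem
    rw [← hF] at hz
    refine ⟨y + (-1 : k) • z, by simp [hzy], ?_⟩
    have hz' : Represents F σ (1 - n i) 0 ((-1 : k) • z) :=
      Represents.of_mem_succ hanti (Submodule.zero_mem _)
        (Submodule.smul_mem _ _ (hanti (by omega) hz))
    simpa using hy.add hz'
  choose y hy hrep using hgen
  obtain ⟨S, hSN, hSe⟩ := hlift y hy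
  have hSpow : ∀ i l, S ((N ^ l) (e i)) = (N ^ l) (y i) := by
    intro i l
    have h : Commute S (N ^ l) := Commute.pow_right (show S * N = N * S from hSN) l
    rw [← Module.End.mul_apply, h.eq, Module.End.mul_apply, hSe]
  have hS : ∀ a, ∀ x ∈ F a, Represents F σ a x (S x) := by
    intro a x hx
    rw [hspan] at hx
    induction hx using Submodule.span_induction with
    | mem x hx =>
      obtain ⟨i, l, hl, rfl⟩ := hx
      have h := (hrep i).pow_apply hNF hν hcomm l
      rw [hSpow]
      rcases hl.eq_or_lt with hl | hl
      · rwa [hl, show (2 * l + 1 - n i : ℤ) = 1 - n i + 2 * l by ring]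
      · exact Represents.of_mem_succ hanti (hanti (by omega) h.1) (hanti (by omega) h.2.1)
    | zero =>
      rw [map_zero]
      exact Represents.of_mem_succ hanti (Submodule.zero_mem _) (Submodule.zero_mem _)
    | add x x' _ _ h h' => rw [map_add]; exact h.add h'
    | smul c x _ h => rw [map_smul]; exact h.smul c
  exact ⟨S, fun a x hx => (hS a x hx).2.1, hSN, fun a x hx _ => (hS a x hx).2.2⟩
end
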